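/- Let ℓ ∈ ℕ with ℓ ≥ 1. Then x·k^{(ℓ)}(x) − (2/π)·sin(x − ℓπ/2) tends to 0 as |x| → ∞ (i.e., both as x → +∞ and as x → −∞); consequently the function x ↦ x·k^{(ℓ)}(x) is bounded outside any neighbourhood of the origin, so k^{(ℓ)}(x) = O(x^{-1}) as |x| → ∞. -/

import Mathlib

open MeasureTheory Finset

/-- `sinc x = sin x / x` for `x ≠ 0`, `sinc 0 = 1`. -/
noncomputable def sinc (x : ℝ) : ℝ := if x = 0 then 1 else Real.sin x / x

/-- The polynomial `p_ℓ(w) = Σ_{j=0}^{ℓ-1} (1/2^j) · C(ℓ+j-1, ℓ-1) · w^{ℓ-j-1}/(ℓ-j-1)!`. -/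
noncomputable def pPoly (ℓ : ℕ) (w : ℝ) : ℝ :=
  ∑ j ∈ Finset.range ℓ,
    (1 / 2 ^ j : ℝ) * (Nat.choose (ℓ + j - 1) (ℓ - 1)) * w ^ (ℓ - j - 1) /
      (Nat.factorial (ℓ - j - 1))

/-- `g_ℓ(x) = ∫_ℝ e^{-|u|} p_ℓ(|u|) sinc(x−u) du`. -/
noncomputable def gFun (ℓ : ℕ) (x : ℝ) : ℝ :=
  ∫ u : ℝ, Real.exp (-|u|) * pPoly ℓ |u| * sinc (x - u)

/-- The kernel function `k^{(ℓ)}` for `ℓ ≥ 1`. -/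
noncomputable def kl (ℓ : ℕ) (x : ℝ) : ℝ :=
  (1 / (Real.pi * 2 ^ (ℓ - 1))) *
    ∑ n ∈ Finset.range (2 * ℓ + 1),
      (-1 : ℝ) ^ n * (Nat.choose (2 * ℓ) n) * iteratedDeriv n (gFun ℓ) x


theorem cb_step (x y : ℂ) (h : x + y = 1) (n m : ℕ) :
    ∑ j ∈ range (m+1), ((n+1+j).choose j : ℂ) * x^(n+2) * y^j =
    ∑ j ∈ range (m+1), ((n+j).choose j : ℂ) * x^(n+1) * y^j
      - ((n+m+1).choose m : ℂ) * x^(n+1) * y^(m+1) := by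
  obtain rfl : x = 1 - y := by rw [← h]; ring
  induction m with
  | zero => simp; ring
  | succ m ih =>
    rw [sum_range_succ, ih, sum_range_succ _ (m+1)]
    have h1 : ((n + 1 + (m+1)).choose (m+1) : ℂ) = (n+m+1).choose m + (n+m+1).choose (m+1) := by
      rw [show n + 1 + (m+1) = (n+m+1)+1 by ring, Nat.choose_succ_succ]; push_cast; rfl
    have h2 : n + (m+1) + 1 = n + 1 + (m+1) := by ring
    rw [h2, h1, show n + (m+1) = n+m+1 by ring]
    ring

theorem cb (x y : ℂ) (h : x + y = 1) (n m : ℕ) :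
    ∑ j ∈ range (m+1), ((n+j).choose j : ℂ) * x^(n+1) * y^j +
    ∑ j ∈ range (n+1), ((m+j).choose j : ℂ) * y^(m+1) * x^j = 1 := by
  induction n with
  | zero =>
    obtain rfl : x = 1 - y := by rw [← h]; ring
    simp
    rw [← mul_sum, mul_comm, geom_sum_mul_neg]; ring
  | succ n ih =>
    rw [sum_range_succ _ (n+1)]
    have := cb_step x y h n m
    rw [show n + 1 + 1 = n + 2 by ring, this]
    have h3 : (m + (n+1)).choose (n+1) = (n+m+1).choose m := by
      rw [show m + (n+1) = n+m+1 by ring]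
      exact Nat.choose_symm_of_eq_add (by ring)
    rw [h3]
    linear_combination ih

theorem cb2 (ℓ : ℕ) (hℓ : 1 ≤ ℓ) (w : ℝ) :
    ∑ j ∈ range ℓ, (1 / 2 ^ j : ℂ) * (Nat.choose (ℓ + j - 1) (ℓ - 1)) *
      (1 / (1 + Complex.I * w)^(ℓ - j) + 1 / (1 - Complex.I * w)^(ℓ-j))
      = 2^ℓ / ((1 + Complex.I * w) * (1 - Complex.I * w))^ℓ := by
  have ha : (1 + Complex.I * w) ≠ 0 := by
    intro h; have := congrArg Complex.re h; simp at this
  have hb : (1 - Complex.I * w) ≠ 0 := by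
    intro h; have := congrArg Complex.re h; simp at this
  obtain ⟨n, rfl⟩ : ∃ n, ℓ = n + 1 := ⟨ℓ - 1, by omega⟩
  generalize hx : (1 + Complex.I * w) = a at *
  generalize hy : (1 - Complex.I * w) = b at *
  have hab : a / 2 + b / 2 = 1 := by rw [← hx, ← hy]; ring
  have := cb _ _ hab n n
  rw [← sum_add_distrib] at this
  rw [eq_div_iff (pow_ne_zero _ (mul_ne_zero ha hb)), sum_mul]
  refine Eq.trans ?_ ((congrArg (fun z => (2:ℂ)^(n+1) * z) this).trans (mul_one _))
  rw [mul_sum]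
  apply sum_congr rfl
  intro j hj
  have hj' : j < n + 1 := by simpa using hj
  obtain ⟨k, hk⟩ : ∃ k, n + 1 = j + k := ⟨n + 1 - j, by omega⟩
  have h3 : (n + 1 + j - 1).choose (n + 1 - 1) = (n+j).choose j := by
    rw [show n + 1 + j - 1 = n + j by omega, show n + 1 - 1 = n by omega]
    exact Nat.choose_symm_of_eq_add (by ring)
  rw [h3, show n + 1 - j = k by omega, hk]
  simp only [div_pow, mul_pow, pow_add]
  field_simp
  ring

theorem intR (m : ℕ) : IntegrableOn (fun u : ℝ => u^m * Real.exp (-u)) (Set.Ioi 0) := by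
  have := Real.GammaIntegral_convergent (s := (m:ℝ)+1) (by positivity)
  refine this.congr_fun (fun x hx => ?_) measurableSet_Ioi
  simp [mul_comm]

theorem normE (r : ℂ) (hr : r.re = 1) (m : ℕ) (u : ℝ) (hu : 0 ≤ u) :
    ‖(u:ℂ)^m * Complex.exp (-(r*u))‖ = u^m * Real.exp (-u) := by
  rw [norm_mul, Complex.norm_exp, norm_pow]
  simp [hr, abs_of_nonneg hu]

theorem intC (r : ℂ) (hr : r.re = 1) (m : ℕ) :
    IntegrableOn (fun u : ℝ => (u:ℂ)^m * Complex.exp (-(r*u))) (Set.Ioi 0) := by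
  refine Integrable.mono' (intR m) ?_ ?_
  · apply Continuous.aestronglyMeasurable; fun_prop
  · filter_upwards [ae_restrict_mem measurableSet_Ioi] with u hu
    rw [normE r hr m u (le_of_lt hu)]

theorem tendC (r : ℂ) (hr : r.re = 1) (m : ℕ) :
    Filter.Tendsto (fun u : ℝ => (u:ℂ)^m * Complex.exp (-(r*u))) Filter.atTop (nhds 0) := by
  rw [tendsto_zero_iff_norm_tendsto_zero]
  refine (Real.tendsto_pow_mul_exp_neg_atTop_nhds_zero m).congr' ?_
  filter_upwards [Filter.eventually_ge_atTop 0] with u hu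
  rw [normE r hr m u hu]

theorem derE (r : ℂ) (u : ℝ) :
    HasDerivAt (fun u : ℝ => Complex.exp (-(r*u))) (-r * Complex.exp (-(r*u))) u := by
  have h1 : HasDerivAt (fun z : ℂ => Complex.exp (-(r*z))) (-r * Complex.exp (-(r*u))) u := by
    have := ((hasDerivAt_id (u:ℂ)).const_mul r).neg.cexp
    simpa [mul_comm] using this
  exact h1.comp_ofReal

theorem valC (r : ℂ) (hr : r.re = 1) (m : ℕ) :
    ∫ u : ℝ in Set.Ioi 0, (u:ℂ)^m * Complex.exp (-(r*u)) = m.factorial / r^(m+1) := by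
  have hr0 : r ≠ 0 := by rintro rfl; simp at hr
  induction m with
  | zero =>
    have := integral_Ioi_of_hasDerivAt_of_tendsto' (a := 0) (fun u _ => derE r u)
      (by simpa [IntegrableOn] using (intC r hr 0).const_mul (-r)) (by simpa using tendC r hr 0)
    rw [integral_const_mul] at this
    simp at this
    simp
    field_simp; exact this
  | succ m ih =>
    have hd : ∀ u : ℝ, HasDerivAt (fun u : ℝ => (u:ℂ)^(m+1) * Complex.exp (-(r*u)))
      ((m+1) * ((u:ℂ)^m * Complex.exp (-(r*u))) + -r * ((u:ℂ)^(m+1) * Complex.exp (-(r*u)))) u := by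
      intro u
      have h1 : HasDerivAt (fun u : ℝ => (u:ℂ)^(m+1)) ((m+1) * (u:ℂ)^m) u := by
        have := (hasDerivAt_pow (m+1) (u:ℂ)).comp_ofReal
        simpa using this
      refine (h1.mul (derE r u)).congr_deriv ?_
      ring
    have i1 := (intC r hr m).const_mul (m+1:ℂ)
    have i2 := (intC r hr (m+1)).const_mul (-r)
    have := integral_Ioi_of_hasDerivAt_of_tendsto' (a := 0) (fun u _ => hd u)
      (i1.add i2) (tendC r hr (m+1))
    rw [integral_add i1 i2, integral_const_mul, integral_const_mul, ih] at this
    simp at this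
    rw [Nat.factorial_succ]
    push_cast
    have h3 : r * (∫ u : ℝ in Set.Ioi 0, (u:ℂ)^(m+1) * Complex.exp (-(r*u))) = (m+1) * (m.factorial / r^(m+1)) := by
      linear_combination -this
    rw [pow_succ r (m+1)]
    field_simp at h3 ⊢
    linear_combination h3

noncomputable def II (H : ℝ → ℂ) (x : ℝ) : ℂ := ∫ w in (-1:ℝ)..1, H w * Complex.exp (Complex.I * w * x)

theorem II_bdd (H : ℝ → ℂ) (_ : Continuous H) : ∃ C, ∀ x, ‖II H x‖ ≤ C := by
  refine ⟨∫ w in (-1:ℝ)..1, ‖H w‖, fun x => ?_⟩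
  refine (intervalIntegral.norm_integral_le_integral_norm (by norm_num)).trans (le_of_eq ?_)
  congr 1; ext w
  rw [norm_mul, Complex.norm_exp]; simp

theorem derI (x w : ℝ) : HasDerivAt (fun w : ℝ => Complex.exp (Complex.I * w * x))
    (Complex.I * x * Complex.exp (Complex.I * w * x)) w := by
  have := derE (-(Complex.I*x)) w
  convert this using 1 <;> [ext w; skip] <;> ring_nf

theorem derI2 (x w : ℝ) : HasDerivAt (fun x : ℝ => Complex.exp (Complex.I * w * x))
    (Complex.I * w * Complex.exp (Complex.I * w * x)) x := by
  have := derE (-(Complex.I*w)) x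
  convert this using 1 <;> [ext w; skip] <;> ring_nf

theorem II_parts (H : ℝ → ℂ) (hH : ContDiff ℝ 1 H) (x : ℝ) :
    x * II H x = -Complex.I * (H 1 * Complex.exp (Complex.I * x) - H (-1) * Complex.exp (-(Complex.I * x)))
      + Complex.I * II (deriv H) x := by
  have h := intervalIntegral.integral_mul_deriv_eq_deriv_mul (a := -1) (b := 1) (u := H) (u' := deriv H)
    (fun w _ => (hH.differentiable (by simp) w).hasDerivAt) (fun w _ => derI x w)
    ((hH.continuous_deriv le_rfl).intervalIntegrable _ _)
    (Continuous.intervalIntegrable (by fun_prop) _ _)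
  have h2 : ∫ w in (-1:ℝ)..1, H w * (Complex.I * x * Complex.exp (Complex.I * w * x)) = Complex.I * x * II H x := by
    rw [II, ← intervalIntegral.integral_const_mul]
    congr 1; ext w; ring
  rw [h2] at h
  change _ = _ - II (deriv H) x at h
  have := Complex.I_sq
  simp at h
  linear_combination -Complex.I * h + (x * II H x) * this

theorem II_tend (H : ℝ → ℂ) (hH : ContDiff ℝ 1 H) (l : Filter ℝ) (hl : Filter.Tendsto (fun x : ℝ => x⁻¹) l (nhds 0)) (hl0 : ∀ᶠ x in l, x ≠ 0) :
    Filter.Tendsto (II H) l (nhds 0) := by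
  obtain ⟨C, hC⟩ := II_bdd _ (hH.continuous_deriv le_rfl)
  have hb : ∀ x : ℝ, ‖x * II H x‖ ≤ ‖H 1‖ + ‖H (-1)‖ + C := by
    intro x
    rw [II_parts H hH]
    refine (norm_add_le _ _).trans ?_
    rw [norm_mul, norm_mul]
    refine add_le_add ?_ (by simpa using hC x)
    simp only [norm_neg, Complex.norm_I, one_mul]
    refine (norm_sub_le _ _).trans ?_
    simp [Complex.norm_exp]
  rw [tendsto_zero_iff_norm_tendsto_zero]
  have h1 : Filter.Tendsto (fun x : ℝ => |x⁻¹| * (‖H 1‖ + ‖H (-1)‖ + C)) l (nhds 0) := by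
    simpa using hl.abs.mul_const (‖H 1‖ + ‖H (-1)‖ + C)
  refine squeeze_zero' (Filter.Eventually.of_forall fun x => norm_nonneg _) ?_ h1
  filter_upwards [hl0] with x hx
  have := hb x
  rw [norm_mul] at this
  rw [abs_inv, ← div_eq_inv_mul, le_div_iff₀ (abs_pos.2 hx)]
  simp at this
  linarith

theorem II_deriv (H : ℝ → ℂ) (hH : Continuous H) (x : ℝ) :
    HasDerivAt (II H) (II (fun w => Complex.I * w * H w) x) x := by
  have := intervalIntegral.hasDerivAt_integral_of_dominated_loc_of_deriv_le (μ := volume) (a := -1) (b := 1)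
    (F := fun (x w : ℝ) => H w * Complex.exp (Complex.I * w * x))
    (F' := fun (x w : ℝ) => Complex.I * w * H w * Complex.exp (Complex.I * w * x))
    (bound := fun w => ‖Complex.I * w * H w‖) (x₀ := x) (s := Set.univ) Filter.univ_mem
    (Filter.Eventually.of_forall fun x => (Continuous.aestronglyMeasurable (by fun_prop)))
    (Continuous.intervalIntegrable (by fun_prop) _ _)
    (Continuous.aestronglyMeasurable (by fun_prop))
    (by
      refine Filter.Eventually.of_forall fun w _ x _ => ?_
      rw [norm_mul _ (Complex.exp _), Complex.norm_exp]; simp)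
    (Continuous.intervalIntegrable (by fun_prop) _ _)
    (by
      refine Filter.Eventually.of_forall fun w _ x _ => ?_
      refine ((derI2 x w).const_mul (H w)).congr_deriv ?_
      ring)
  exact this.2

theorem II_iter (g : ℝ → ℝ) (H : ℝ → ℂ) (hH : Continuous H) (hg : ∀ x, g x = (II H x).re) (n : ℕ) :
    iteratedDeriv n g = fun x => (II (fun w => (Complex.I * w)^n * H w) x).re := by
  induction n with
  | zero => ext x; simp [hg]
  | succ n ih =>
    rw [iteratedDeriv_succ, ih]
    ext x
    have h := II_deriv (fun w => (Complex.I * w)^n * H w) (by fun_prop) x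
    have h2 : HasDerivAt (fun x => (II (fun w => (Complex.I * w)^n * H w) x).re) _ x :=
      (Complex.reCLM.hasFDerivAt.comp_hasDerivAt x h)
    rw [h2.deriv]
    simp only [Complex.reCLM_apply]
    congr 3; ext w; ring

theorem fullI (m : ℕ) (w : ℝ) :
    Integrable (fun u : ℝ => ((|u| : ℝ):ℂ)^m * Complex.exp (-((|u| : ℝ):ℂ)) * Complex.exp (-(Complex.I * w * u))) ∧
    ∫ u : ℝ, ((|u| : ℝ):ℂ)^m * Complex.exp (-((|u| : ℝ):ℂ)) * Complex.exp (-(Complex.I * w * u)) =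
      m.factorial * (1 / (1 + Complex.I * w)^(m+1) + 1 / (1 - Complex.I * w)^(m+1)) := by
  have hp : (1 + Complex.I * (w:ℂ)).re = 1 := by simp
  have hm : (1 - Complex.I * (w:ℂ)).re = 1 := by simp
  have e1 : Set.EqOn (fun u : ℝ => (u:ℂ)^m * Complex.exp (-((1 + Complex.I * w)*u)))
      (fun u : ℝ => ((|u| : ℝ):ℂ)^m * Complex.exp (-((|u| : ℝ):ℂ)) * Complex.exp (-(Complex.I * w * u))) (Set.Ioi 0) := by
    intro u hu
    simp only
    rw [abs_of_pos hu, mul_assoc, ← Complex.exp_add]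
    ring_nf
  have e2 : Set.EqOn (fun u : ℝ => ((-u : ℝ):ℂ)^m * Complex.exp (-((1 - Complex.I * w)*(-u : ℝ))))
      (fun u : ℝ => ((|u| : ℝ):ℂ)^m * Complex.exp (-((|u| : ℝ):ℂ)) * Complex.exp (-(Complex.I * w * u))) (Set.Iic 0) := by
    intro u hu
    simp only
    rw [abs_of_nonpos hu, mul_assoc, ← Complex.exp_add]
    push_cast
    ring_nf
  have i1 := (intC _ hp m).congr_fun e1 measurableSet_Ioi
  have i2 := (IntegrableOn.comp_neg_Iic (μ := volume) (c := (0:ℝ)) (f := fun u : ℝ => (u:ℂ)^m * Complex.exp (-((1 - Complex.I * w)*u)))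
    (by rw [neg_zero, integrableOn_Ici_iff_integrableOn_Ioi]; exact intC _ hm m)).congr_fun e2 measurableSet_Iic
  constructor
  · rw [← integrableOn_univ, ← Set.Iic_union_Ioi (a := (0:ℝ))]
    exact i2.union i1
  · rw [← intervalIntegral.integral_Iic_add_Ioi i2 i1, ← setIntegral_congr_fun measurableSet_Ioi e1,
      ← setIntegral_congr_fun measurableSet_Iic e2,
      integral_comp_neg_Iic 0 (fun u : ℝ => (u:ℂ)^m * Complex.exp (-((1 - Complex.I * w)*u))),
      neg_zero, valC _ hp, valC _ hm]
    ring

noncomputable def fF (ℓ : ℕ) (u : ℝ) : ℝ := Real.exp (-|u|) * pPoly ℓ |u|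

theorem fF_fourier (ℓ : ℕ) (hℓ : 1 ≤ ℓ) (w : ℝ) :
    Integrable (fun u : ℝ => (fF ℓ u : ℂ) * Complex.exp (-(Complex.I * w * u))) ∧
    ∫ u : ℝ, (fF ℓ u : ℂ) * Complex.exp (-(Complex.I * w * u)) =
      2^ℓ / ((1 + Complex.I * w) * (1 - Complex.I * w))^ℓ := by
  have e : (fun u : ℝ => (fF ℓ u : ℂ) * Complex.exp (-(Complex.I * w * u))) =
    fun u : ℝ => ∑ j ∈ range ℓ, (1 / 2 ^ j : ℂ) * (Nat.choose (ℓ + j - 1) (ℓ - 1)) / (Nat.factorial (ℓ - j - 1)) *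
      (((|u| : ℝ):ℂ)^(ℓ-j-1) * Complex.exp (-((|u| : ℝ):ℂ)) * Complex.exp (-(Complex.I * w * u))) := by
    ext u
    simp only [fF, pPoly]
    push_cast
    rw [mul_sum, sum_mul]
    apply sum_congr rfl
    intro j _
    ring
  rw [e]
  have hi : ∀ j ∈ range ℓ, Integrable (fun u : ℝ => (1 / 2 ^ j : ℂ) * (Nat.choose (ℓ + j - 1) (ℓ - 1)) / (Nat.factorial (ℓ - j - 1)) *
      (((|u| : ℝ):ℂ)^(ℓ-j-1) * Complex.exp (-((|u| : ℝ):ℂ)) * Complex.exp (-(Complex.I * w * u)))) :=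
    fun j _ => (fullI _ w).1.const_mul _
  refine ⟨integrable_finsetSum _ hi, ?_⟩
  rw [integral_finsetSum _ hi, ← cb2 ℓ hℓ w]
  apply sum_congr rfl
  intro j hj
  have hj' : j < ℓ := by simpa using hj
  rw [integral_const_mul, (fullI _ w).2, show ℓ - j - 1 + 1 = ℓ - j by omega]
  have : ((ℓ - j - 1).factorial : ℂ) ≠ 0 := by exact_mod_cast Nat.factorial_ne_zero _
  rw [← mul_assoc, div_mul_cancel₀ _ this]

theorem sinc_eq (t : ℝ) : (sinc t : ℂ) = (1/2) * II (fun _ => 1) t := by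
  by_cases ht : t = 0
  · subst ht; simp [sinc, II]; norm_num
  · have h := II_parts (fun _ => 1) contDiff_const t
    have h0 : II (deriv (fun _ : ℝ => (1:ℂ))) t = 0 := by simp [II]
    rw [h0] at h
    have ht' : (t:ℂ) ≠ 0 := by exact_mod_cast ht
    have hs : 2 * Complex.sin t = (Complex.exp (-t * Complex.I) - Complex.exp (t * Complex.I)) * Complex.I := by
      rw [Complex.sin]; ring
    simp only [sinc, ht, if_false]
    push_cast
    rw [div_eq_iff ht']
    rw [show Complex.I * (t:ℂ) = t * Complex.I by ring] at h
    rw [show -(t:ℂ) * Complex.I = -(t * Complex.I) by ring] at hs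
    linear_combination (1/2) * hs - (1/2) * h

theorem gFun_eq (ℓ : ℕ) (hℓ : 1 ≤ ℓ) (x : ℝ) :
    (gFun ℓ x : ℂ) = II (fun w => (1/2) * (2^ℓ / ((1 + Complex.I * w) * (1 - Complex.I * w))^ℓ)) x := by
  have hint : Integrable (fun u => (fF ℓ u : ℂ)) := by
    simpa using (fF_fourier ℓ hℓ 0).1
  unfold gFun
  rw [← integral_complex_ofReal]
  have e1 : ∀ u : ℝ, ((Real.exp (-|u|) * pPoly ℓ |u| * sinc (x - u) : ℝ) : ℂ) =
     ∫ w in (-1:ℝ)..1, (1/2) * ((fF ℓ u : ℂ) * Complex.exp (-(Complex.I * w * u))) * Complex.exp (Complex.I * w * x) := by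
    intro u
    rw [← fF, Complex.ofReal_mul, sinc_eq, II, ← mul_assoc, ← intervalIntegral.integral_const_mul]
    congr 1; ext w
    have he : Complex.exp (Complex.I * w * (x - u : ℝ)) =
        Complex.exp (-(Complex.I * w * u)) * Complex.exp (Complex.I * w * x) := by
      rw [← Complex.exp_add]
      push_cast
      ring_nf
    rw [he]
    ring
  simp_rw [e1]
  rw [← intervalIntegral_integral_swap]
  · unfold II
    congr 1; ext w
    rw [integral_mul_const, integral_const_mul, (fF_fourier ℓ hℓ w).2]
  · have h1 : Integrable (fun z : ℝ × ℝ => (1:ℂ) * (fF ℓ z.2 : ℂ)) ((volume.restrict (Set.uIoc (-1) 1)).prod volume) := by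
      have hc : Integrable (fun _ : ℝ => (1:ℂ)) (volume.restrict (Set.uIoc (-1:ℝ) 1)) := by
        rw [Set.uIoc_of_le (by norm_num)]
        apply integrable_const
      exact hc.mul_prod hint
    have h2 := h1.bdd_mul (c := 1/2) (f := fun z : ℝ × ℝ => (1/2) * Complex.exp (-(Complex.I * z.1 * z.2)) * Complex.exp (Complex.I * z.1 * x))
      (Continuous.aestronglyMeasurable (by fun_prop))
      (by
        refine Filter.Eventually.of_forall fun z => ?_
        rw [norm_mul, norm_mul, Complex.norm_exp, Complex.norm_exp]
        simp)
    refine h2.congr (Filter.Eventually.of_forall fun z => ?_)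
    simp only [Function.uncurry]
    ring

noncomputable def HH (ℓ : ℕ) (w : ℝ) : ℂ := ((1 - Complex.I * w) / (1 + Complex.I * w))^ℓ

theorem ne_p (w : ℝ) : (1 + Complex.I * w) ≠ 0 := by
  intro h; have := congrArg Complex.re h; simp at this

theorem ne_m (w : ℝ) : (1 - Complex.I * w) ≠ 0 := by
  intro h; have := congrArg Complex.re h; simp at this

theorem HH_smooth (ℓ : ℕ) : ContDiff ℝ 2 (HH ℓ) := by
  unfold HH
  have h : ContDiff ℝ 2 (fun w : ℝ => (w:ℂ)) := Complex.ofRealCLM.contDiff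
  simp only [div_eq_mul_inv]
  refine ContDiff.pow (ContDiff.mul ?_ (ContDiff.inv ?_ ne_p)) ℓ
  · exact contDiff_const.sub (contDiff_const.mul h)
  · exact contDiff_const.add (contDiff_const.mul h)

theorem kl_eq (ℓ : ℕ) (hℓ : 1 ≤ ℓ) (x : ℝ) : kl ℓ x = (1 / Real.pi) * (II (HH ℓ) x).re := by
  set P : ℝ → ℂ := fun w => (1/2) * (2^ℓ / ((1 + Complex.I * w) * (1 - Complex.I * w))^ℓ) with hP
  have hPc : Continuous P := by
    rw [hP]
    refine continuous_const.mul (continuous_const.div (by fun_prop) fun w => ?_)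
    exact pow_ne_zero _ (mul_ne_zero (ne_p w) (ne_m w))
  have hg : ∀ x, gFun ℓ x = (II P x).re := by
    intro x; rw [← gFun_eq ℓ hℓ x]; simp
  have hs : ∑ n ∈ range (2 * ℓ + 1), (-1 : ℝ) ^ n * (Nat.choose (2 * ℓ) n) * iteratedDeriv n (gFun ℓ) x
      = (2^(ℓ-1) * II (HH ℓ) x).re := by
    have e1 : ∀ n, (-1 : ℝ) ^ n * (Nat.choose (2 * ℓ) n) * iteratedDeriv n (gFun ℓ) x =
        (((-1 : ℝ) ^ n * (Nat.choose (2 * ℓ) n) : ℝ) * II (fun w => (Complex.I * w)^n * P w) x).re := by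
      intro n
      rw [Complex.re_ofReal_mul, II_iter _ P hPc hg]
    simp_rw [e1]
    rw [← Complex.re_sum]
    congr 1
    unfold II
    simp_rw [← intervalIntegral.integral_const_mul]
    rw [← intervalIntegral.integral_finsetSum]
    · congr 1; ext w
      have hb : (1 - Complex.I * w)^(2*ℓ) = ∑ n ∈ range (2*ℓ+1), (-1:ℂ)^n * (Nat.choose (2*ℓ) n) * (Complex.I * w)^n := by
        rw [sub_eq_neg_add, add_pow]
        apply sum_congr rfl
        intro n _
        rw [neg_pow]; simp; ring
      have h2 : 2^(ℓ-1) * HH ℓ w = (1 - Complex.I * w)^(2*ℓ) * P w := by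
        simp only [hP, HH]
        obtain ⟨n, rfl⟩ : ∃ n, ℓ = n + 1 := ⟨ℓ - 1, by omega⟩
        have := ne_p w
        have := ne_m w
        rw [show n + 1 - 1 = n by omega, two_mul, pow_add _ (n+1) (n+1), mul_pow, div_pow, pow_succ (2:ℂ) n]
        field_simp
      rw [← mul_assoc, h2, hb, sum_mul, sum_mul]
      apply sum_congr rfl
      intro n _
      push_cast
      ring
    · intro n _
      exact Continuous.intervalIntegrable (by fun_prop) _ _
  unfold kl
  rw [hs]
  have : ((2:ℂ)^(ℓ-1)) = ((2^(ℓ-1) : ℝ) : ℂ) := by push_cast; rfl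
  rw [this, Complex.re_ofReal_mul]
  field_simp

theorem HH_one (ℓ : ℕ) : HH ℓ 1 = Complex.exp (-(ℓ * Real.pi / 2 * Complex.I)) := by
  have h : (1 - Complex.I * (1:ℝ)) / (1 + Complex.I * (1:ℝ)) = Complex.exp (-(Real.pi / 2 * Complex.I)) := by
    rw [Complex.exp_neg, Complex.exp_pi_div_two_mul_I, div_eq_iff (ne_p 1), Complex.inv_I]
    push_cast
    linear_combination Complex.I_sq
  rw [HH, h, ← Complex.exp_nat_mul]
  ring_nf

theorem HH_neg_one (ℓ : ℕ) : HH ℓ (-1) = Complex.exp (ℓ * Real.pi / 2 * Complex.I) := by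
  have h : (1 - Complex.I * (-1:ℝ)) / (1 + Complex.I * (-1:ℝ)) = Complex.exp (Real.pi / 2 * Complex.I) := by
    rw [Complex.exp_pi_div_two_mul_I, div_eq_iff (ne_p (-1))]
    push_cast
    linear_combination Complex.I_sq
  rw [HH, h, ← Complex.exp_nat_mul]
  ring_nf

theorem kl_main (ℓ : ℕ) (hℓ : 1 ≤ ℓ) (x : ℝ) :
    x * kl ℓ x - (2 / Real.pi) * Real.sin (x - ℓ * Real.pi / 2)
      = (1 / Real.pi) * (Complex.I * II (deriv (HH ℓ)) x).re := by
  have h := II_parts (HH ℓ) ((HH_smooth ℓ).of_le (by norm_num)) x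
  have h2 : -Complex.I * (HH ℓ 1 * Complex.exp (Complex.I * x) - HH ℓ (-1) * Complex.exp (-(Complex.I * x)))
      = ((2 * Real.sin (x - ℓ * Real.pi / 2) : ℝ) : ℂ) := by
    rw [HH_one, HH_neg_one, ← Complex.exp_add, ← Complex.exp_add]
    push_cast
    rw [Complex.sin]
    ring_nf
  rw [h2] at h
  have h3 := congrArg Complex.re h
  rw [Complex.re_ofReal_mul, Complex.add_re, Complex.ofReal_re] at h3
  rw [kl_eq ℓ hℓ]
  linear_combination (1 / Real.pi) * h3

theorem kl_tend (ℓ : ℕ) (hℓ : 1 ≤ ℓ) (l : Filter ℝ) (hl : Filter.Tendsto (fun x : ℝ => x⁻¹) l (nhds 0))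
    (hl0 : ∀ᶠ x in l, x ≠ 0) :
    Filter.Tendsto (fun x : ℝ => x * kl ℓ x - (2 / Real.pi) * Real.sin (x - ℓ * Real.pi / 2)) l (nhds 0) := by
  simp_rw [kl_main ℓ hℓ]
  have hd : ContDiff ℝ 1 (deriv (HH ℓ)) := by
    have := HH_smooth ℓ
    rw [show (2 : WithTop ℕ∞) = 1 + 1 by norm_num, contDiff_succ_iff_deriv] at this
    exact this.2.2
  have h := ((Complex.continuous_re.tendsto _).comp ((II_tend _ hd l hl hl0).const_mul Complex.I)).const_mul (1 / Real.pi)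
  simpa using h

theorem kl_bdd (ℓ : ℕ) (hℓ : 1 ≤ ℓ) : ∃ C : ℝ, ∀ x : ℝ, |x * kl ℓ x| ≤ C := by
  obtain ⟨C, hC⟩ := II_bdd (deriv (HH ℓ)) ((HH_smooth ℓ).continuous_deriv (by norm_num))
  refine ⟨(2 / Real.pi) + (1 / Real.pi) * C, fun x => ?_⟩
  have h := kl_main ℓ hℓ x
  rw [sub_eq_iff_eq_add'] at h
  rw [h]
  have hpi := Real.pi_pos
  refine (abs_add_le _ _).trans (add_le_add ?_ ?_)
  · rw [abs_mul, abs_of_pos (by positivity)]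
    exact mul_le_of_le_one_right (by positivity) (Real.abs_sin_le_one _)
  · rw [abs_mul, abs_of_pos (a := 1 / Real.pi) (by positivity)]
    refine mul_le_mul_of_nonneg_left ?_ (by positivity)
    refine (Complex.abs_re_le_norm _).trans ?_
    simpa using hC x

theorem kl_O (ℓ : ℕ) (hℓ : 1 ≤ ℓ) (l : Filter ℝ) (hl0 : ∀ᶠ x in l, x ≠ 0) :
    Asymptotics.IsBigO l (kl ℓ) (fun x : ℝ => x⁻¹) := by
  obtain ⟨C, hC⟩ := kl_bdd ℓ hℓ
  refine Asymptotics.IsBigO.of_bound C ?_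
  filter_upwards [hl0] with x hx
  have := hC x
  rw [norm_inv, ← div_eq_mul_inv, le_div_iff₀ (by simpa using hx), ← norm_mul, mul_comm]
  exact this

open Filter Asymptotics in
theorem stmt_18 (ℓ : ℕ) (hℓ : 1 ≤ ℓ) :
    Tendsto (fun x : ℝ => x * kl ℓ x - (2 / Real.pi) * Real.sin (x - ℓ * Real.pi / 2))
        atTop (nhds 0) ∧
      Tendsto (fun x : ℝ => x * kl ℓ x - (2 / Real.pi) * Real.sin (x - ℓ * Real.pi / 2))
        atBot (nhds 0) ∧
      (∀ ε : ℝ, 0 < ε → ∃ C : ℝ, ∀ x : ℝ, ε ≤ |x| → |x * kl ℓ x| ≤ C) ∧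
      (kl ℓ) =O[atTop] (fun x : ℝ => x⁻¹) ∧ (kl ℓ) =O[atBot] (fun x : ℝ => x⁻¹) := by
  have t0 : ∀ᶠ x : ℝ in atTop, x ≠ 0 := eventually_ne_atTop 0
  have b0 : ∀ᶠ x : ℝ in atBot, x ≠ 0 := eventually_ne_atBot 0
  refine ⟨kl_tend ℓ hℓ _ tendsto_inv_atTop_zero t0, kl_tend ℓ hℓ _ tendsto_inv_atBot_zero b0, ?_,
    kl_O ℓ hℓ _ t0, kl_O ℓ hℓ _ b0⟩
  intro ε _
  obtain ⟨C, hC⟩ := kl_bdd ℓ hℓ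
  exact ⟨C, fun x _ => hC x⟩
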